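/- Let G be a C_{4k}-free bipartite graph and v a vertex of G. Then v is in the support of G if and only if there exists a maximum matching M of G such that v is M-unsaturated. -/

import Mathlib

open scoped Classical

namespace C4kPaper

open SimpleGraph

variable {V : Type*} [Fintype V] [DecidableEq V]

/-- The null space of the adjacency matrix of `G`, as a set of vectors. -/
noncomputable def nullSet (G : SimpleGraph V) : Set (V → ℝ) :=
  {x | Matrix.mulVec (G.adjMatrix ℝ) x = 0}

/-- The null space of the adjacency matrix of `G`, as a submodule of `ℝ^V`. -/
noncomputable def nullModule (G : SimpleGraph V) : Submodule ℝ (V → ℝ) :=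
  LinearMap.ker (G.adjMatrix ℝ).mulVecLin

/-- The nullity of `G`: the dimension of the null space of its adjacency matrix. -/
noncomputable def nullity (G : SimpleGraph V) : ℕ :=
  Module.finrank ℝ (nullModule G)

/-- The rank of the adjacency matrix of `G` over `ℝ`. -/
noncomputable def rk (G : SimpleGraph V) : ℕ :=
  (G.adjMatrix ℝ).rank

/-- The support of `G`: vertices where some null space vector is nonzero. -/
def supp (G : SimpleGraph V) : Set V :=
  {v | ∃ x ∈ nullSet G, x v ≠ 0}

/-- The core of `G`: the neighbors of the support. -/
def core (G : SimpleGraph V) : Set V :=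
  {u | ∃ v ∈ supp G, G.Adj u v}

/-- The N-part of `G`: vertices neither in the support nor in the core. -/
def npart (G : SimpleGraph V) : Set V :=
  (supp G ∪ core G)ᶜ

/-- `G` is bipartite. -/
def IsBipartite (G : SimpleGraph V) : Prop :=
  ∃ s : Set V, ∀ ⦃u v : V⦄, G.Adj u v → (u ∈ s ↔ v ∉ s)

/-- `G` has no cycle whose length is a multiple of 4. -/
def C4kFree (G : SimpleGraph V) : Prop :=
  ∀ (v : V) (c : G.Walk v v), c.IsCycle → ¬ (4 ∣ c.length)

/-- `M` is a maximum matching of `G`. -/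
def IsMaximumMatching (G : SimpleGraph V) (M : G.Subgraph) : Prop :=
  M.IsMatching ∧ ∀ M' : G.Subgraph, M'.IsMatching → M'.edgeSet.ncard ≤ M.edgeSet.ncard

/-- The matching number of `G`. -/
noncomputable def matchNum (G : SimpleGraph V) : ℕ :=
  sSup {n | ∃ M : G.Subgraph, M.IsMatching ∧ M.edgeSet.ncard = n}

/-- `s` is an independent set of `G`. -/
def IsIndep (G : SimpleGraph V) (s : Set V) : Prop :=
  ∀ ⦃u⦄, u ∈ s → ∀ ⦃w⦄, w ∈ s → ¬ G.Adj u w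

/-- `s` is a maximum independent set of `G`. -/
def IsMaxIndep (G : SimpleGraph V) (s : Set V) : Prop :=
  IsIndep G s ∧ ∀ t : Set V, IsIndep G t → t.ncard ≤ s.ncard

/-- The independence number of `G`. -/
noncomputable def indepNum (G : SimpleGraph V) : ℕ :=
  sSup {n | ∃ s : Set V, IsIndep G s ∧ s.ncard = n}

/-- An `(M,x)`-alternating walk `w₀, w₁, …, w_j` (here `w_i = p.getVert i`):
for all `0 ≤ i < ⌊(j-1)/2⌋`, `{w_{2i}, w_{2i+1}} ∈ M` and `x_{w_{2i}} · x_{w_{2i+2}} < 0`. -/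
def MxAltWalk (G : SimpleGraph V) (M : G.Subgraph) (x : V → ℝ) {v u : V}
    (p : G.Walk v u) : Prop :=
  ∀ i : ℕ, i < (p.length - 1) / 2 →
    M.Adj (p.getVert (2 * i)) (p.getVert (2 * i + 1)) ∧
      x (p.getVert (2 * i)) * x (p.getVert (2 * i + 2)) < 0

/-- A maximal `(M,x)`-alternating walk: one not properly contained in a longer
`(M,x)`-alternating walk from the same start. -/
def MaximalMxAltWalk (G : SimpleGraph V) (M : G.Subgraph) (x : V → ℝ) {v u : V}
    (p : G.Walk v u) : Prop :=
  MxAltWalk G M x p ∧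
    ∀ (u' : V) (q : G.Walk v u'), MxAltWalk G M x q → p.support <+: q.support →
      q.length = p.length

/-- An `M`-alternating walk starting with an edge not in `M`:
the `i`-th edge belongs to `M` iff `i` is odd. -/
def MAltWalk (G : SimpleGraph V) (M : G.Subgraph) {v u : V} (p : G.Walk v u) : Prop :=
  ∀ i : ℕ, i < p.length → (M.Adj (p.getVert i) (p.getVert (i + 1)) ↔ Odd i)

/-- Vertices reachable from `v` by an even-length `M`-alternating path. -/
def Re (G : SimpleGraph V) (M : G.Subgraph) (v : V) : Set V :=
  {u | ∃ p : G.Walk v u, p.IsPath ∧ MAltWalk G M p ∧ Even p.length}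

/-- Vertices reachable from `v` by an odd-length `M`-alternating path. -/
def Ro (G : SimpleGraph V) (M : G.Subgraph) (v : V) : Set V :=
  {u | ∃ p : G.Walk v u, p.IsPath ∧ MAltWalk G M p ∧ Odd p.length}

section Graph

variable {W : Type*} {G : SimpleGraph W}

lemma exists_isPath_of_injOn {w : ℕ → W} (n : ℕ) (hadj : ∀ i < n, G.Adj (w i) (w (i + 1)))
    (hinj : Set.InjOn w (Set.Iic n)) :
    ∃ p : G.Walk (w 0) (w n), p.IsPath ∧ p.length = n ∧ ∀ z ∈ p.support, ∃ i ≤ n, w i = z := by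
  induction n with
  | zero => exact ⟨.nil, by simp⟩
  | succ n ih =>
    obtain ⟨p, hp, hl, hs⟩ := ih (fun i hi ↦ hadj i (by lia))
      (hinj.mono (Set.Iic_subset_Iic.2 (by lia)))
    refine ⟨p.concat (hadj n (by lia)), hp.concat (fun hmem ↦ ?_) _, by simp [hl], fun z hz ↦ ?_⟩
    · obtain ⟨i, hi, h⟩ := hs _ hmem
      have := hinj (Set.mem_Iic.2 (by lia)) (Set.mem_Iic.2 le_rfl) h
      lia
    · rw [Walk.support_concat, List.mem_append] at hz
      rcases hz with hz | hz
      · obtain ⟨i, hi, h⟩ := hs _ hz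
        exact ⟨i, by lia, h⟩
      · exact ⟨n + 1, le_rfl, (List.mem_singleton.1 hz).symm⟩

lemma exists_isCycle_of_injOn {w : ℕ → W} {n : ℕ} (hn : 2 ≤ n)
    (hadj : ∀ i < n, G.Adj (w i) (w (i + 1))) (hinj : Set.InjOn w (Set.Iic n))
    (hclose : G.Adj (w n) (w 0)) :
    ∃ (v : W) (c : G.Walk v v), c.IsCycle ∧ c.length = n + 1 := by
  obtain ⟨p, hp, hl, -⟩ := exists_isPath_of_injOn n hadj hinj
  refine ⟨_, .cons hclose p, (Walk.cons_isCycle_iff p hclose).2 ⟨hp, fun h ↦ ?_⟩, by simp [hl]⟩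
  have := hp.length_eq_one_of_mem_edges (Sym2.eq_swap ▸ h)
  lia

/-- A closed sequence `a 0, b 0, a 1, b 1, …, a n, b n, a 0` of distinct vertices yields a cycle. -/
lemma exists_isCycle_of_interleaved {a b : ℕ → W} {n : ℕ} (hn : 1 ≤ n)
    (hab : ∀ i ≤ n, G.Adj (a i) (b i)) (hba : ∀ i < n, G.Adj (b i) (a (i + 1)))
    (hclose : G.Adj (b n) (a 0)) (ha : Set.InjOn a (Set.Iic n)) (hb : Set.InjOn b (Set.Iic n))
    (hne : ∀ i ≤ n, ∀ j ≤ n, a i ≠ b j) :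
    ∃ (v : W) (c : G.Walk v v), c.IsCycle ∧ c.length = 2 * (n + 1) := by
  set w : ℕ → W := fun i ↦ if i % 2 = 0 then a (i / 2) else b (i / 2) with hw
  have hev (i : ℕ) : w (2 * i) = a i := by simp [hw]
  have hod (i : ℕ) : w (2 * i + 1) = b i := by
    simp only [hw]
    rw [if_neg (by lia), show (2 * i + 1) / 2 = i by lia]
  have h := exists_isCycle_of_injOn (G := G) (w := w) (n := 2 * n + 1) (by lia) ?_ ?_ ?_
  · simpa [mul_add] using h
  · intro i hi
    obtain ⟨k, rfl | rfl⟩ := Nat.even_or_odd' i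
    · rw [hev, hod]
      exact hab k (by lia)
    · rw [hod, show 2 * k + 1 + 1 = 2 * (k + 1) by ring, hev]
      exact hba k (by lia)
  · intro i hi j hj h
    rw [Set.mem_Iic] at hi hj
    obtain ⟨k, rfl | rfl⟩ := Nat.even_or_odd' i <;> obtain ⟨l, rfl | rfl⟩ := Nat.even_or_odd' j <;>
      simp only [hev, hod] at h
    · rw [ha (Set.mem_Iic.2 (by lia)) (Set.mem_Iic.2 (by lia)) h]
    · exact (hne _ (by lia) _ (by lia) h).elim
    · exact (hne _ (by lia) _ (by lia) h.symm).elim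
    · rw [hb (Set.mem_Iic.2 (by lia)) (Set.mem_Iic.2 (by lia)) h]
  · rw [hod, show 0 = 2 * 0 from rfl, hev]
    exact hclose

end Graph

section Matching

variable {W : Type*} [Finite W] {G : SimpleGraph W}

lemma exists_isMatching_remove {M : G.Subgraph} (hM : M.IsMatching) {a b : W} (hab : M.Adj a b) :
    ∃ M' : G.Subgraph, M'.IsMatching ∧ M'.verts = M.verts \ {a, b} ∧
      M'.edgeSet.ncard + 1 = M.edgeSet.ncard ∧
      ∀ x y, M.Adj x y → x ≠ a → x ≠ b → M'.Adj x y := by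
  have key : ∀ x y, M.Adj x y → x ≠ a → x ≠ b → y ≠ a ∧ y ≠ b := by
    rintro x y h hxa hxb
    exact ⟨fun e ↦ hxb (hM.eq_of_adj_right (e ▸ h) hab.symm),
      fun e ↦ hxa (hM.eq_of_adj_right (e ▸ h) hab)⟩
  refine ⟨M.induce (M.verts \ {a, b}), ?_, rfl, ?_, ?_⟩
  · intro x hx
    obtain ⟨y, hy, hu⟩ := hM hx.1
    have hx' := hx.2
    simp only [Set.mem_insert_iff, Set.mem_singleton_iff, not_or] at hx'
    have := key x y hy hx'.1 hx'.2
    exact ⟨y, ⟨hx, ⟨M.edge_vert hy.symm, by simpa using this⟩, hy⟩, fun z hz ↦ hu z hz.2.2⟩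
  · have : (M.induce (M.verts \ {a, b})).edgeSet = M.edgeSet \ {s(a, b)} := by
      ext e
      induction e with | _ x y
      simp only [Subgraph.mem_edgeSet, Subgraph.induce_adj, Set.mem_sdiff, Set.mem_singleton_iff,
        Set.mem_insert_iff, Sym2.eq_iff]
      constructor
      · rintro ⟨h1, h2, h3⟩
        exact ⟨h3, by tauto⟩
      · rintro ⟨h1, h2⟩
        have hx : x ≠ a := fun e ↦ h2 (.inl ⟨e, hM.eq_of_adj_left (e ▸ h1) hab⟩)
        have hx' : x ≠ b := fun e ↦ h2 (.inr ⟨e, hM.eq_of_adj_left (e ▸ h1) hab.symm⟩)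
        have := key x y h1 hx hx'
        exact ⟨⟨M.edge_vert h1, by tauto⟩, ⟨M.edge_vert h1.symm, by tauto⟩, h1⟩
    rw [this]
    exact Set.ncard_sdiff_singleton_add_one hab (Set.toFinite _)
  · intro x y h hxa hxb
    have := key x y h hxa hxb
    exact ⟨⟨M.edge_vert h, by simp [hxa, hxb]⟩, ⟨M.edge_vert h.symm, by simpa using this⟩, h⟩

lemma exists_isMatching_add {M : G.Subgraph} (hM : M.IsMatching) {a b : W} (hab : G.Adj a b)
    (ha : a ∉ M.verts) (hb : b ∉ M.verts) :
    ∃ M' : G.Subgraph, M'.IsMatching ∧ M'.verts = M.verts ∪ {a, b} ∧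
      M'.edgeSet.ncard = M.edgeSet.ncard + 1 ∧ ∀ x y, M.Adj x y → M'.Adj x y := by
  refine ⟨M ⊔ G.subgraphOfAdj hab, hM.sup (.subgraphOfAdj hab) ?_, by simp, ?_, ?_⟩
  · rw [hM.support_eq_verts, (Subgraph.IsMatching.subgraphOfAdj hab).support_eq_verts]
    simp [ha, hb]
  · rw [Subgraph.edgeSet_sup, edgeSet_subgraphOfAdj, Set.union_singleton]
    exact Set.ncard_insert_of_notMem (fun h ↦ ha (M.edge_vert h)) (Set.toFinite _)
  · intro x y h
    exact Or.inl h

/-- Shifting a matching along an alternating path that ends at an unsaturated vertex. -/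
lemma exists_isMatching_shift (k : ℕ) {a b : ℕ → W} (hba : ∀ i < k, G.Adj (b i) (a (i + 1)))
    (hinj : Set.InjOn a (Set.Iic k)) (hne : ∀ i ≤ k, ∀ j < k, a i ≠ b j)
    {M : G.Subgraph} (hM : M.IsMatching) (hab : ∀ i < k, M.Adj (a i) (b i))
    (hk : a k ∉ M.verts) :
    ∃ M' : G.Subgraph, M'.IsMatching ∧ M'.edgeSet.ncard = M.edgeSet.ncard ∧ a 0 ∉ M'.verts ∧
      M'.verts ⊆ insert (a k) M.verts := by
  induction k generalizing M with
  | zero => exact ⟨M, hM, rfl, hk, Set.subset_insert _ _⟩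
  | succ k ih =>
    have hak := hab k (by lia)
    have hane : ∀ i ≤ k + 1, i ≠ k → a i ≠ a k := fun i hi hik h ↦
      hik (hinj (Set.mem_Iic.2 hi) (Set.mem_Iic.2 (by lia)) h)
    obtain ⟨M₀, hM₀, hv₀, hc₀, hA₀⟩ := exists_isMatching_remove hM hak
    obtain ⟨M₁, hM₁, hv₁, hc₁, hA₁⟩ := exists_isMatching_add hM₀ (hba k (by lia))
      (by simp [hv₀]) (by simp [hv₀, hk])
    obtain ⟨M', hM', hc', h0, hv'⟩ := ih (fun i hi ↦ hba i (by lia))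
      (hinj.mono (Set.Iic_subset_Iic.2 (by lia))) (fun i hi j hj ↦ hne i (by lia) j (by lia)) hM₁
      (fun i hi ↦ hA₁ _ _ (hA₀ _ _ (hab i (by lia)) (hane i (by lia) (by lia))
        (hne i (by lia) k (by lia))))
      (by
        simp only [hv₁, hv₀, Set.mem_union, Set.mem_sdiff, Set.mem_insert_iff,
          Set.mem_singleton_iff]
        have := hane (k + 1) le_rfl (by lia)
        have := hne k (by lia) k (by lia)
        tauto)
    refine ⟨M', hM', by lia, h0, hv'.trans ?_⟩
    rw [hv₁, hv₀]
    have h1 := M.edge_vert hak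
    have h2 := M.edge_vert hak.symm
    rintro z (rfl | ⟨h, -⟩ | rfl | rfl) <;> simp [*]

lemma exists_isMaximumMatching (G : SimpleGraph W) : ∃ M : G.Subgraph, IsMaximumMatching G M := by
  obtain ⟨M, hM, h⟩ := (Set.toFinite {M : G.Subgraph | M.IsMatching}).exists_maximalFor
    (fun M ↦ M.edgeSet.ncard) _ ⟨⊥, fun v hv ↦ hv.elim⟩
  exact ⟨M, hM, fun M' hM' ↦ (le_total _ _).elim id (h hM')⟩

end Matching

section NullSpace

variable {W : Type*} {G : SimpleGraph W}

lemma exists_adj_mul_neg [Fintype W] {x : W → ℝ} {a b : W} (hb : ((G.adjMatrix ℝ).mulVec x) b = 0)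
    (hab : G.Adj b a) (ha : x a ≠ 0) : ∃ c, G.Adj b c ∧ x a * x c < 0 := by
  by_contra! h
  rw [adjMatrix_mulVec_apply] at hb
  have h0 : ∑ c ∈ G.neighborFinset b, x a * x c = 0 := by rw [← Finset.mul_sum, hb, mul_zero]
  have := (Finset.sum_eq_zero_iff_of_nonneg fun c hc ↦ h c (by simpa using hc)).1 h0 a
    (by simpa using hab)
  exact ha (mul_self_eq_zero.1 this)

lemma even_of_alternating_sign {f : ℕ → ℝ} {i m : ℕ}
    (h : ∀ j, i ≤ j → j < i + m → f j * f (j + 1) < 0) (heq : f (i + m) = f i) (hi : f i ≠ 0) :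
    Even m := by
  have key : ∀ l ≤ m, 0 < (-1) ^ l * (f i * f (i + l)) := by
    intro l
    induction l with
    | zero => intro; simpa using mul_self_pos.2 hi
    | succ l ih =>
      intro hl
      have h1 := ih (by lia)
      have h2 := h (i + l) (by lia) (by lia)
      have h3 := mul_neg_of_pos_of_neg h1 h2
      have h4 : (-1) ^ l * (f i * f (i + l)) * (f (i + l) * f (i + l + 1)) =
        -((-1) ^ (l + 1) * (f i * f (i + (l + 1)))) * (f (i + l)) ^ 2 := by
        rw [← add_assoc]; ring
      rw [h4] at h3
      by_contra! hneg
      nlinarith [mul_nonneg (neg_nonneg.2 hneg) (sq_nonneg (f (i + l)))]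
  by_contra hm
  have := key m le_rfl
  rw [heq, (Nat.not_even_iff_odd.1 hm).neg_one_pow] at this
  nlinarith [mul_self_nonneg (f i)]

/-- In a graph without cycles of length divisible by four, an alternating sequence along which a
vector changes sign at each step does not revisit a vertex. -/
lemma injOn_of_alternating (hc : C4kFree G) {M : G.Subgraph} (hM : M.IsMatching) {x : W → ℝ}
    {a b : ℕ → W} (n : ℕ) (hab : ∀ i < n, M.Adj (a i) (b i))
    (hba : ∀ i < n, G.Adj (b i) (a (i + 1))) (hsign : ∀ i < n, x (a i) * x (a (i + 1)) < 0)
    (hne : ∀ i < n, ∀ j < n, a i ≠ b j) : Set.InjOn a (Set.Iic n) := by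
  induction n with
  | zero => intro i hi j hj _; simp_all
  | succ n ih =>
    have ih := ih (fun i hi ↦ hab i (by lia)) (fun i hi ↦ hba i (by lia))
      (fun i hi ↦ hsign i (by lia)) (fun i hi j hj ↦ hne i (by lia) j (by lia))
    have hnew : ∀ i ≤ n, a (n + 1) ≠ a i := by
      intro i hi heq
      obtain ⟨m, rfl⟩ := Nat.exists_eq_add_of_le hi
      have heven : Even (m + 1) := even_of_alternating_sign (f := fun j ↦ x (a j)) (i := i)
        (fun j _ hj ↦ hsign j (by lia)) (by simp only [← add_assoc, heq])
        (left_ne_zero_of_mul (hsign i (by lia)).ne)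
      obtain ⟨r, hr⟩ := heven
      have hinj : Set.InjOn (fun j ↦ a (i + j)) (Set.Iic m) := fun j hj l hl h ↦ by
        rw [Set.mem_Iic] at hj hl
        have := ih (Set.mem_Iic.2 (by lia)) (Set.mem_Iic.2 (by lia)) h
        lia
      obtain ⟨v, c, hcyc, hl⟩ := exists_isCycle_of_interleaved (G := G)
        (a := fun j ↦ a (i + j)) (b := fun j ↦ b (i + j)) (n := m) (by lia)
        (fun j hj ↦ (hab _ (by lia)).adj_sub) (fun j hj ↦ hba _ (by lia))
        (heq ▸ hba (i + m) (by lia)) hinj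
        (fun j hj l hl h ↦ by
          rw [Set.mem_Iic] at hj hl
          refine hinj (Set.mem_Iic.2 hj) (Set.mem_Iic.2 hl) ?_
          have h' : b (i + j) = b (i + l) := h
          exact hM.eq_of_adj_right (h' ▸ hab (i + j) (by lia)) (hab (i + l) (by lia)))
        (fun j hj l hl ↦ hne _ (by lia) _ (by lia))
      exact hc v c hcyc (hl ▸ ⟨r, by lia⟩)
    intro i hi j hj h
    rw [Set.mem_Iic] at hi hj
    rcases Nat.lt_or_ge n i with hi' | hi' <;> rcases Nat.lt_or_ge n j with hj' | hj'
    · lia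
    · obtain rfl : i = n + 1 := by lia
      exact (hnew j hj' h).elim
    · obtain rfl : j = n + 1 := by lia
      exact (hnew i hi' h.symm).elim
    · exact ih hi' hj' h

/-- If `x` is annihilated at the saturated vertices on the side opposite to `u` and `x u ≠ 0`, then
`M` can be modified to miss `u` without saturating new vertices on the opposite side. -/
lemma exists_isMatching_avoiding [Fintype W] {s : Set W}
    (hs : ∀ ⦃u v : W⦄, G.Adj u v → (u ∈ s ↔ v ∉ s)) (hc : C4kFree G) {M : G.Subgraph}
    (hM : M.IsMatching) {x : W → ℝ} {u : W} (hu : x u ≠ 0)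
    (hx : ∀ z ∈ M.verts, (z ∈ s ↔ u ∉ s) → ((G.adjMatrix ℝ).mulVec x) z = 0) :
    ∃ M' : G.Subgraph, M'.IsMatching ∧ M'.edgeSet.ncard = M.edgeSet.ncard ∧ u ∉ M'.verts ∧
      ∀ z ∈ M'.verts, (z ∈ s ↔ u ∉ s) → z ∈ M.verts := by
  have step : ∀ a, x a ≠ 0 → (a ∈ s ↔ u ∈ s) → a ∈ M.verts →
      ∃ b c, M.Adj a b ∧ G.Adj b c ∧ x a * x c < 0 := by
    intro a ha has haM
    obtain ⟨b, hb, -⟩ := hM haM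
    have := hs hb.adj_sub
    obtain ⟨c, hc⟩ := exists_adj_mul_neg (hx b (M.edge_vert hb.symm) (by tauto)) hb.adj_sub.symm ha
    exact ⟨b, c, hb, hc⟩
  choose! mate next hmate hnext hsgn using step
  set a : ℕ → W := fun i ↦ next^[i] u
  have hsucc (i : ℕ) : a (i + 1) = next (a i) := Function.iterate_succ_apply' next i u
  have inv : ∀ n, (∀ i < n, a i ∈ M.verts) → ∀ i ≤ n, x (a i) ≠ 0 ∧ (a i ∈ s ↔ u ∈ s) := by
    intro n hn i
    induction i with
    | zero => exact fun _ ↦ ⟨hu, Iff.rfl⟩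
    | succ i ih =>
      intro hi
      obtain ⟨h1, h2⟩ := ih (by lia)
      have hv := hn i (by lia)
      have e1 := hs (hmate _ h1 h2 hv).adj_sub
      have e2 := hs (hnext _ h1 h2 hv)
      rw [hsucc]
      exact ⟨right_ne_zero_of_mul (hsgn _ h1 h2 hv).ne, by tauto⟩
  have hne : ∀ n, (∀ i < n, a i ∈ M.verts) → ∀ i ≤ n, ∀ j < n, a i ≠ mate (a j) := by
    intro n hn i hi j hj h
    obtain ⟨-, h2⟩ := inv n hn i hi
    obtain ⟨h3, h4⟩ := inv n hn j hj.le
    have := hs (hmate _ h3 h4 (hn j hj)).adj_sub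
    rw [← h] at this
    tauto
  have hadj : ∀ n, (∀ i < n, a i ∈ M.verts) → ∀ i < n, M.Adj (a i) (mate (a i)) ∧
      G.Adj (mate (a i)) (a (i + 1)) ∧ x (a i) * x (a (i + 1)) < 0 := by
    intro n hn i hi
    obtain ⟨h1, h2⟩ := inv n hn i hi.le
    rw [hsucc]
    exact ⟨hmate _ h1 h2 (hn i hi), hnext _ h1 h2 (hn i hi), hsgn _ h1 h2 (hn i hi)⟩
  have hinj : ∀ n, (∀ i < n, a i ∈ M.verts) → Set.InjOn a (Set.Iic n) := fun n hn ↦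
    injOn_of_alternating hc hM (b := fun i ↦ mate (a i)) (x := x) n
      (fun i hi ↦ (hadj n hn i hi).1) (fun i hi ↦ (hadj n hn i hi).2.1)
      (fun i hi ↦ (hadj n hn i hi).2.2) (fun i hi ↦ hne n hn i hi.le)
  have hex : ∃ n, a n ∉ M.verts := by
    by_contra! hall
    refine not_injective_infinite_finite a fun i j h ↦ ?_
    exact hinj (max i j) (fun l _ ↦ hall l) (Set.mem_Iic.2 (le_max_left _ _))
      (Set.mem_Iic.2 (le_max_right _ _)) h
  have hlt : ∀ i < Nat.find hex, a i ∈ M.verts := fun i hi ↦ not_not.1 (Nat.find_min hex hi)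
  obtain ⟨M', hM', hcard, h0, hv⟩ := exists_isMatching_shift (Nat.find hex)
    (b := fun i ↦ mate (a i)) (fun i hi ↦ (hadj _ hlt i hi).2.1) (hinj _ hlt) (hne _ hlt) hM
    (fun i hi ↦ (hadj _ hlt i hi).1) (Nat.find_spec hex)
  refine ⟨M', hM', hcard, h0, fun z hz hzs ↦ ?_⟩
  rcases hv hz with rfl | hz
  · have := (inv _ hlt _ le_rfl).2
    tauto
  · exact hz

lemma exists_mulVec_eq_single [Fintype W] [DecidableEq W] {v : W} (hv : v ∉ supp G) :
    ∃ y : W → ℝ, (G.adjMatrix ℝ).mulVec y = Pi.single v 1 := by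
  by_contra h
  obtain ⟨f, hf, hle⟩ := Submodule.exists_le_ker_of_notMem
    (p := LinearMap.range (G.adjMatrix ℝ).mulVecLin) (v := Pi.single v 1) (by simpa using h)
  refine hv ⟨fun i ↦ f (Pi.single i 1), ?_, hf⟩
  ext j
  have := hle ⟨Pi.single j 1, rfl⟩
  rw [LinearMap.mem_ker, Matrix.mulVecLin_apply, Matrix.mulVec_single_one,
    LinearMap.pi_apply_eq_sum_univ] at this
  have hsingle (i : W) : (fun k ↦ if i = k then (1 : ℝ) else 0) = Pi.single i 1 := by
    ext k
    simp [Pi.single_apply, eq_comm]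
  simpa [hsingle, Matrix.mulVec, dotProduct, G.adj_comm j] using this

end NullSpace


/-- `v` is in the support iff `v` is unsaturated by some maximum matching. -/
theorem stmt7 (G : SimpleGraph V) (hb : IsBipartite G) (hc : C4kFree G) (v : V) :
    v ∈ supp G ↔ ∃ M : G.Subgraph, IsMaximumMatching G M ∧ v ∉ M.verts := by
  obtain ⟨s, hs⟩ := hb
  constructor
  · rintro ⟨x, hx, hxv⟩
    obtain ⟨M, hM, hmax⟩ := exists_isMaximumMatching G
    obtain ⟨M', hM', hcard, hv, -⟩ :=
      exists_isMatching_avoiding hs hc hM hxv fun z _ _ ↦ congrFun hx z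
    exact ⟨M', ⟨hM', hcard ▸ hmax⟩, hv⟩
  · rintro ⟨M, ⟨hM, hmax⟩, hv⟩
    by_contra hsupp
    obtain ⟨y, hy⟩ := exists_mulVec_eq_single hsupp
    obtain ⟨w, hvw, hw⟩ : ∃ w, G.Adj v w ∧ y w ≠ 0 := by
      by_contra! h
      have := congrFun hy v
      rw [adjMatrix_mulVec_apply, Finset.sum_eq_zero fun c hc ↦ h c (by simpa using hc)] at this
      simp at this
    obtain ⟨M', hM', hcard, hw', hsub⟩ := exists_isMatching_avoiding hs hc hM hw fun z hz _ ↦ by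
      rw [hy, Pi.single_eq_of_ne (ne_of_mem_of_not_mem hz hv)]
    obtain ⟨M'', hM'', -, hcard', -⟩ :=
      exists_isMatching_add hM' hvw (fun h ↦ hv (hsub v h (hs hvw))) hw'
    have := hmax M'' hM''
    lia

end C4kPaper
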